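/- (Stationary memoryless sources, first order.) Let X be a stationary memoryless source with generic distribution P_X on 𝒳 whose entropy H(X) is finite. Then for all ε, δ ∈ [0,1) satisfying ε + δ < 1, it holds that R(ε,δ|X) = R*(ε,δ|X) = H(X). -/

import Mathlib

open Filter MeasureTheory

namespace NY

/-- A probability distribution on a set, given by its point mass function. -/
structure Dist (α : Type*) where
  p : α → ℝ
  nonneg : ∀ x, 0 ≤ p x
  hasSum : HasSum p 1

/-- The probability of a set under a distribution. -/
noncomputable def Dist.pr {α : Type*} (P : Dist α) (A : Set α) : ℝ := ∑' x : A, P.p x.1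

/-- 𝒰* : nonempty finite strings over the code alphabet 𝒰 = {1,…,K}. -/
abbrev Word (K : ℕ) := {u : List (Fin K) // u ≠ []}

/-- Length of a string, as a real number. -/
noncomputable def wlen {K : ℕ} (u : Word K) : ℝ := u.1.length

/-- Error probability of a variable-length code (φ, ψ). -/
noncomputable def errP {α : Type*} {K : ℕ} (P : Dist α) (φ : α → Word K) (ψ : Word K → α) : ℝ :=
  P.pr {x | ψ (φ x) ≠ x}

/-- Overflow probability of an encoder φ with threshold η. -/
noncomputable def ovP {α : Type*} {K : ℕ} (P : Dist α) (φ : α → Word K) (η : ℝ) : ℝ :=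
  P.pr {x | wlen (φ x) > η}

/-- A general source: for each blocklength n, a distribution on 𝒳^n. -/
abbrev Source (𝒳 : Type*) := (n : ℕ) → Dist (Fin n → 𝒳)

/-- The limit as ν ↓ 0 of a function g which is nonincreasing in ν
(the limit exists by monotonicity and equals the supremum over ν > 0). -/
noncomputable def limNu (g : ℝ → ℝ) : ℝ := sSup (g '' Set.Ioi (0 : ℝ))

variable {𝒳 : Type*}

/-- A rate R ≥ 0 is (ε,δ)-achievable. -/
def FirstAch (K : ℕ) (X : Source 𝒳) (ε δ R : ℝ) : Prop :=
  0 ≤ R ∧ ∃ (φ : ∀ n, (Fin n → 𝒳) → Word K) (ψ : ∀ n, Word K → (Fin n → 𝒳)),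
    limsup (fun n => errP (X n) (φ n) (ψ n)) atTop ≤ ε ∧
    limsup (fun n => ovP (X n) (φ n) ((n : ℝ) * R)) atTop ≤ δ

/-- The first-order (ε,δ)-optimum threshold R(ε,δ|X). -/
noncomputable def Ropt (K : ℕ) (X : Source 𝒳) (ε δ : ℝ) : ℝ :=
  sInf {R | FirstAch K X ε δ R}

/-- L is (ε,δ,R)-achievable (second order). -/
def SecondAch (K : ℕ) (X : Source 𝒳) (ε δ R L : ℝ) : Prop :=
  ∃ (φ : ∀ n, (Fin n → 𝒳) → Word K) (ψ : ∀ n, Word K → (Fin n → 𝒳)),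
    limsup (fun n => errP (X n) (φ n) (ψ n)) atTop ≤ ε ∧
    limsup (fun n => ovP (X n) (φ n) ((n : ℝ) * R + Real.sqrt (n : ℝ) * L)) atTop ≤ δ

/-- The second-order (ε,δ,R)-optimum threshold L(ε,δ,R|X). -/
noncomputable def Lopt (K : ℕ) (X : Source 𝒳) (ε δ R : ℝ) : ℝ :=
  sInf {L | SecondAch K X ε δ R L}

/-- A rate R ≥ 0 is optimistically (ε,δ)-achievable. -/
def OptFirstAch (K : ℕ) (X : Source 𝒳) (ε δ R : ℝ) : Prop :=
  0 ≤ R ∧ ∃ (φ : ∀ n, (Fin n → 𝒳) → Word K) (ψ : ∀ n, Word K → (Fin n → 𝒳)),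
    ∀ γ > (0 : ℝ), ∃ ns : ℕ → ℕ, StrictMono ns ∧ ∀ i,
      errP (X (ns i)) (φ (ns i)) (ψ (ns i)) ≤ ε + γ ∧
      ovP (X (ns i)) (φ (ns i)) ((ns i : ℝ) * R) ≤ δ + γ

/-- The optimistic first-order (ε,δ)-optimum threshold R*(ε,δ|X). -/
noncomputable def RoptStar (K : ℕ) (X : Source 𝒳) (ε δ : ℝ) : ℝ :=
  sInf {R | OptFirstAch K X ε δ R}

/-- L is optimistically (ε,δ,R)-achievable. -/
def OptSecondAch (K : ℕ) (X : Source 𝒳) (ε δ R L : ℝ) : Prop :=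
  ∃ (φ : ∀ n, (Fin n → 𝒳) → Word K) (ψ : ∀ n, Word K → (Fin n → 𝒳)),
    ∀ γ > (0 : ℝ), ∃ ns : ℕ → ℕ, StrictMono ns ∧ ∀ i,
      errP (X (ns i)) (φ (ns i)) (ψ (ns i)) ≤ ε + γ ∧
      ovP (X (ns i)) (φ (ns i)) ((ns i : ℝ) * R + Real.sqrt (ns i : ℝ) * L) ≤ δ + γ

/-- The optimistic second-order (ε,δ,R)-optimum threshold L*(ε,δ,R|X). -/
noncomputable def LoptStar (K : ℕ) (X : Source 𝒳) (ε δ R : ℝ) : ℝ :=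
  sInf {L | OptSecondAch K X ε δ R L}

/-- A rate R ≥ 0 is type I (ε,δ)-achievable. -/
def TypeIAch (K : ℕ) (X : Source 𝒳) (ε δ R : ℝ) : Prop :=
  0 ≤ R ∧ ∃ (φ : ∀ n, (Fin n → 𝒳) → Word K) (ψ : ∀ n, Word K → (Fin n → 𝒳)),
    limsup (fun n => errP (X n) (φ n) (ψ n)) atTop ≤ ε ∧
    liminf (fun n => ovP (X n) (φ n) ((n : ℝ) * R)) atTop ≤ δ

/-- R†(ε,δ|X). -/
noncomputable def Rdagger (K : ℕ) (X : Source 𝒳) (ε δ : ℝ) : ℝ :=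
  sInf {R | TypeIAch K X ε δ R}

/-- A rate R ≥ 0 is type II (ε,δ)-achievable. -/
def TypeIIAch (K : ℕ) (X : Source 𝒳) (ε δ R : ℝ) : Prop :=
  0 ≤ R ∧ ∃ (φ : ∀ n, (Fin n → 𝒳) → Word K) (ψ : ∀ n, Word K → (Fin n → 𝒳)),
    liminf (fun n => errP (X n) (φ n) (ψ n)) atTop ≤ ε ∧
    limsup (fun n => ovP (X n) (φ n) ((n : ℝ) * R)) atTop ≤ δ

/-- R‡(ε,δ|X). -/
noncomputable def Rddagger (K : ℕ) (X : Source 𝒳) (ε δ : ℝ) : ℝ :=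
  sInf {R | TypeIIAch K X ε δ R}

/-- H̄_γ(X) := inf{ R : limsup_n Pr{ (1/n) log(1/P_{X^n}(X^n)) > R } ≤ γ }. -/
noncomputable def Hbar (K : ℕ) (X : Source 𝒳) (γ : ℝ) : ℝ :=
  sInf {R | limsup (fun n =>
    (X n).pr {x | Real.logb (K : ℝ) (1 / (X n).p x) / (n : ℝ) > R}) atTop ≤ γ}

/-- H̄*_γ(X) (optimistic version, with liminf). -/
noncomputable def HbarStar (K : ℕ) (X : Source 𝒳) (γ : ℝ) : ℝ :=
  sInf {R | liminf (fun n =>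
    (X n).pr {x | Real.logb (K : ℝ) (1 / (X n).p x) / (n : ℝ) > R}) atTop ≤ γ}

/-- H̄_γ(R|X) := inf{ L : limsup_n Pr{ (1/n) log(1/P_{X^n}(X^n)) > R + L/√n } ≤ γ }. -/
noncomputable def Hbar2 (K : ℕ) (X : Source 𝒳) (γ R : ℝ) : ℝ :=
  sInf {L | limsup (fun n =>
    (X n).pr {x | Real.logb (K : ℝ) (1 / (X n).p x) / (n : ℝ)
      > R + L / Real.sqrt (n : ℝ)}) atTop ≤ γ}

/-- H̄*_γ(R|X) (optimistic version, with liminf). -/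
noncomputable def Hbar2Star (K : ℕ) (X : Source 𝒳) (γ R : ℝ) : ℝ :=
  sInf {L | liminf (fun n =>
    (X n).pr {x | Real.logb (K : ℝ) (1 / (X n).p x) / (n : ℝ)
      > R + L / Real.sqrt (n : ℝ)}) atTop ≤ γ}

/-- F(ε,R) := limsup_n inf_{A : Pr(A) ≥ 1−ε} Pr{ −(1/n) log P_{X^n}(X^n) ≥ R, X^n ∈ A }. -/
noncomputable def Fspec (K : ℕ) (X : Source 𝒳) (ε R : ℝ) : ℝ :=
  limsup (fun n =>
    sInf ((fun A : Set (Fin n → 𝒳) =>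
        (X n).pr (A ∩ {x | -Real.logb (K : ℝ) ((X n).p x) / (n : ℝ) ≥ R})) ''
      {A | (X n).pr A ≥ 1 - ε})) atTop

/-- H̃_{ε,δ}(X) := inf{ R : F(ε,R) ≤ δ }. -/
noncomputable def Htilde (K : ℕ) (X : Source 𝒳) (ε δ : ℝ) : ℝ :=
  sInf {R | Fspec K X ε R ≤ δ}

/-- G_{ε,δ}(X). -/
noncomputable def Gfirst (K : ℕ) (X : Source 𝒳) (ε δ : ℝ) : ℝ :=
  sInf {R | limNu (fun ν => limsup (fun n =>
    sInf ((fun A : Set (Fin n → 𝒳) =>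
        (X n).pr (A ∩ {x | -Real.logb (K : ℝ) ((X n).p x / (X n).pr A) / (n : ℝ) ≥ R})) ''
      {A | (X n).pr A ≥ 1 - ε - ν})) atTop) ≤ δ}

/-- G*_{ε,δ}(X) (optimistic version, with liminf). -/
noncomputable def GfirstStar (K : ℕ) (X : Source 𝒳) (ε δ : ℝ) : ℝ :=
  sInf {R | limNu (fun ν => liminf (fun n =>
    sInf ((fun A : Set (Fin n → 𝒳) =>
        (X n).pr (A ∩ {x | -Real.logb (K : ℝ) ((X n).p x / (X n).pr A) / (n : ℝ) ≥ R})) ''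
      {A | (X n).pr A ≥ 1 - ε - ν})) atTop) ≤ δ}

/-- G_{ε,δ}(R|X). -/
noncomputable def Gsecond (K : ℕ) (X : Source 𝒳) (ε δ R : ℝ) : ℝ :=
  sInf {L | limNu (fun ν => limsup (fun n =>
    sInf ((fun A : Set (Fin n → 𝒳) =>
        (X n).pr (A ∩ {x | -Real.logb (K : ℝ) ((X n).p x / (X n).pr A) / (n : ℝ)
          ≥ R + L / Real.sqrt (n : ℝ)})) ''
      {A | (X n).pr A ≥ 1 - ε - ν})) atTop) ≤ δ}

/-- G*_{ε,δ}(R|X) (optimistic version, with liminf). -/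
noncomputable def GsecondStar (K : ℕ) (X : Source 𝒳) (ε δ R : ℝ) : ℝ :=
  sInf {L | limNu (fun ν => liminf (fun n =>
    sInf ((fun A : Set (Fin n → 𝒳) =>
        (X n).pr (A ∩ {x | -Real.logb (K : ℝ) ((X n).p x / (X n).pr A) / (n : ℝ)
          ≥ R + L / Real.sqrt (n : ℝ)})) ''
      {A | (X n).pr A ≥ 1 - ε - ν})) atTop) ≤ δ}

/-- A rate R is optimistically ε-achievable by fixed-length codes. -/
def FixAchR (K : ℕ) (X : Source 𝒳) (ε R : ℝ) : Prop :=
  ∃ (M : ℕ → ℕ) (φ : ∀ n, (Fin n → 𝒳) → Fin (M n)) (ψ : ∀ n, Fin (M n) → (Fin n → 𝒳)),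
    ∀ γ > (0 : ℝ), ∃ ns : ℕ → ℕ, StrictMono ns ∧ ∀ i,
      (X (ns i)).pr {x | ψ (ns i) (φ (ns i) x) ≠ x} ≤ ε + γ ∧
      Real.logb (K : ℝ) (M (ns i) : ℝ) / (ns i : ℝ) ≤ R + γ

/-- R^f(ε|X). -/
noncomputable def Rfix (K : ℕ) (X : Source 𝒳) (ε : ℝ) : ℝ :=
  sInf {R | FixAchR K X ε R}

/-- A real L is optimistically (ε,R)-achievable by fixed-length codes. -/
def FixAchL (K : ℕ) (X : Source 𝒳) (ε R L : ℝ) : Prop :=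
  ∃ (M : ℕ → ℕ) (φ : ∀ n, (Fin n → 𝒳) → Fin (M n)) (ψ : ∀ n, Fin (M n) → (Fin n → 𝒳)),
    ∀ γ > (0 : ℝ), ∃ ns : ℕ → ℕ, StrictMono ns ∧ ∀ i,
      (X (ns i)).pr {x | ψ (ns i) (φ (ns i) x) ≠ x} ≤ ε + γ ∧
      Real.logb (K : ℝ) ((M (ns i) : ℝ) / (K : ℝ) ^ ((ns i : ℝ) * R)) / Real.sqrt (ns i : ℝ)
        ≤ L + γ

/-- L^f(ε,R|X). -/
noncomputable def Lfix (K : ℕ) (X : Source 𝒳) (ε R : ℝ) : ℝ :=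
  sInf {L | FixAchL K X ε R L}

open Topology in
theorem wlln {𝒳 : Type*} [Countable 𝒳] (pX : Dist 𝒳) (X : Source 𝒳)
    (hX : ∀ (n : ℕ) (x : Fin n → 𝒳), (X n).p x = ∏ i, pX.p (x i))
    (f : 𝒳 → ℝ) (hf : Summable fun x => pX.p x * f x) (τ : ℝ) (hτ : 0 < τ) :
    Tendsto (fun n : ℕ => (X n).pr {x | τ ≤ |(∑ i, f (x i)) / n - ∑' x, pX.p x * f x|})
      atTop (𝓝 0) := by
  letI : MeasurableSpace 𝒳 := ⊤
  let q : PMF 𝒳 := ⟨fun x => ENNReal.ofReal (pX.p x), by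
    have := ENNReal.ofReal_tsum_of_nonneg pX.nonneg pX.hasSum.summable
    rw [pX.hasSum.tsum_eq, ENNReal.ofReal_one] at this
    rw [this]
    exact ENNReal.summable.hasSum⟩
  have hq : ∀ x, q x = ENNReal.ofReal (pX.p x) := fun x => rfl
  have hq1 : ∀ x, q.toMeasure {x} = ENNReal.ofReal (pX.p x) := fun x => by
    rw [PMF.toMeasure_apply_singleton _ _ (measurableSet_singleton x), hq]
  have hfm : Measurable f := measurable_from_top
  have hint : Integrable f q.toMeasure := by
    refine ⟨hfm.aestronglyMeasurable, ?_⟩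
    unfold HasFiniteIntegral
    rw [lintegral_countable']
    have e : ∀ x, ‖f x‖ₑ * q.toMeasure {x} = ENNReal.ofReal (‖pX.p x * f x‖) := fun x => by
      rw [hq1, ← ofReal_norm, ← ENNReal.ofReal_mul (norm_nonneg _), norm_mul, mul_comm,
        Real.norm_of_nonneg (pX.nonneg x)]
    simp_rw [e]
    rw [← ENNReal.ofReal_tsum_of_nonneg (fun _ => norm_nonneg _) hf.norm]
    exact ENNReal.ofReal_lt_top
  have hmean : ∫ x, f x ∂q.toMeasure = ∑' x, pX.p x * f x := by
    rw [PMF.integral_eq_tsum _ _ hint]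
    refine tsum_congr fun x => ?_
    rw [hq, ENNReal.toReal_ofReal (pX.nonneg x), smul_eq_mul]
  let ν : Measure (ℕ → 𝒳) := Measure.infinitePi (fun _ : ℕ => q.toMeasure)
  have hmp : ∀ i : ℕ, MeasurePreserving (fun ω : ℕ → 𝒳 => ω i) ν q.toMeasure :=
    fun i => measurePreserving_eval_infinitePi (fun _ : ℕ => q.toMeasure) i
  have hind : ProbabilityTheory.iIndepFun (fun (i : ℕ) (ω : ℕ → 𝒳) => f (ω i)) ν :=
    ProbabilityTheory.iIndepFun_infinitePi (P := fun _ : ℕ => q.toMeasure) (X := fun _ => f) (fun _ => hfm)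
  have hslln := ProbabilityTheory.strong_law_ae_real (μ := ν)
    (fun (i : ℕ) (ω : ℕ → 𝒳) => f (ω i))
    ((hmp 0).integrable_comp_of_integrable hint)
    (fun i j hij => hind.indepFun hij)
    (fun i => ⟨(hfm.comp (measurable_pi_apply i)).aemeasurable,
      (hfm.comp (measurable_pi_apply 0)).aemeasurable, by
      have a := (Measure.map_map (μ := ν) hfm (measurable_pi_apply i))
      have b := (Measure.map_map (μ := ν) hfm (measurable_pi_apply 0))
      have a' := (hmp i).map_eq
      have b' := (hmp 0).map_eq
      simp only [Function.comp_def] at a b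
      rw [← a, ← b]
      erw [a', b']⟩)
  have hm0 : ∫ ω, f (ω 0) ∂ν = ∑' x, pX.p x * f x := by
    rw [← hmean, ← (hmp 0).map_eq, integral_map (measurable_pi_apply 0).aemeasurable
      hfm.aestronglyMeasurable]
  rw [hm0] at hslln
  have hTM := tendstoInMeasure_of_tendsto_ae (μ := ν)
    (f := fun (n : ℕ) (ω : ℕ → 𝒳) => (∑ i ∈ Finset.range n, f (ω i)) / n)
    (g := fun _ => ∑' x, pX.p x * f x)
    (fun n => by
      apply Measurable.aestronglyMeasurable
      apply Measurable.div_const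
      exact Finset.measurable_sum _ fun i _ => hfm.comp (measurable_pi_apply i)) hslln
  rw [tendstoInMeasure_iff_measureReal_norm] at hTM
  refine (hTM τ hτ).congr fun n => ?_
  set B : Set (Fin n → 𝒳) := {x | τ ≤ |(∑ i, f (x i)) / n - ∑' x, pX.p x * f x|} with hB
  let g : (ℕ → 𝒳) → (Fin n → 𝒳) := fun ω i => ω i
  have e1 : {ω : ℕ → 𝒳 | τ ≤ ‖(∑ i ∈ Finset.range n, f (ω i)) / (n : ℝ) - ∑' x, pX.p x * f x‖}
      = g ⁻¹' B := by
    ext ω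
    simp [hB, g, Finset.sum_range]
  have hg : Measurable g := measurable_pi_lambda _ fun i => measurable_pi_apply _
  rw [e1, measureReal_def, ← tsum_measure_preimage_singleton (Set.to_countable B)
    (fun y _ => hg (measurableSet_singleton y))]
  have e2 : ∀ y : Fin n → 𝒳, ν (g ⁻¹' {y}) = ENNReal.ofReal ((X n).p y) := by
    intro y
    obtain rfl | hn := Nat.eq_zero_or_pos n
    · have : g ⁻¹' {y} = Set.univ := by
        ext ω; simp; exact Subsingleton.elim _ _
      rw [this, hX]; simp [ν]
    have : g ⁻¹' {y} = Set.pi (Finset.range n : Set ℕ)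
        (fun i => if h : i < n then {y ⟨i, h⟩} else Set.univ) := by
      ext ω
      simp only [Set.mem_preimage, Set.mem_singleton_iff, Set.mem_pi, Finset.coe_range, Set.mem_Iio]
      constructor
      · rintro rfl i hi
        simp [hi, g]
      · intro h
        ext i
        simpa [g] using h i i.2
    rw [this]
    refine (Measure.infinitePi_pi (μ := fun _ : ℕ => q.toMeasure) (fun i hi => trivial)).trans ?_
    rw [Finset.prod_range, hX, ENNReal.ofReal_prod_of_nonneg (fun i _ => pX.nonneg _)]
    refine Finset.prod_congr rfl fun i _ => ?_
    simp [hq1]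
  simp_rw [e2]
  have e3 := ENNReal.ofReal_tsum_of_nonneg (f := fun b : ↥B => (X n).p b.1)
    (fun y => (X n).nonneg _) ((X n).hasSum.summable.subtype B)
  rw [← e3, ENNReal.toReal_ofReal (tsum_nonneg fun y => (X n).nonneg _)]
  rfl

theorem pr_eq {α : Type*} (P : Dist α) (A : Set α) : P.pr A = ∑' x, A.indicator P.p x :=
  tsum_subtype A P.p

theorem pr_summ {α : Type*} (P : Dist α) (A : Set α) : Summable (A.indicator P.p) :=
  P.hasSum.summable.indicator A

theorem pr_nonneg {α : Type*} (P : Dist α) (A : Set α) : 0 ≤ P.pr A :=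
  tsum_nonneg fun x => P.nonneg _

theorem pr_mono' {α : Type*} (P : Dist α) {A B : Set α} (h : ∀ x ∈ A, P.p x ≠ 0 → x ∈ B) :
    P.pr A ≤ P.pr B := by
  rw [pr_eq, pr_eq]
  refine Summable.tsum_le_tsum (fun x => ?_) (pr_summ P A) (pr_summ P B)
  by_cases hA : x ∈ A
  · by_cases h0 : P.p x = 0
    · rw [Set.indicator_of_mem hA, h0]
      exact Set.indicator_nonneg (fun _ _ => P.nonneg _) _
    · simp [hA, h x hA h0]
  · rw [Set.indicator_of_notMem hA]
    exact Set.indicator_nonneg (fun _ _ => P.nonneg _) _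

theorem pr_univ {α : Type*} (P : Dist α) : P.pr Set.univ = 1 := by
  rw [pr_eq, Set.indicator_univ, P.hasSum.tsum_eq]

theorem pr_le_one {α : Type*} (P : Dist α) (A : Set α) : P.pr A ≤ 1 :=
  (pr_mono' P fun x _ _ => Set.mem_univ x).trans_eq (pr_univ P)

theorem pr_union {α : Type*} (P : Dist α) (A B : Set α) : P.pr (A ∪ B) ≤ P.pr A + P.pr B := by
  rw [pr_eq, pr_eq, pr_eq, ← (pr_summ P A).tsum_add (pr_summ P B)]
  refine Summable.tsum_le_tsum (fun x => ?_) (pr_summ P _) ((pr_summ P A).add (pr_summ P B))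
  have := P.nonneg x
  by_cases hA : x ∈ A <;> by_cases hB : x ∈ B <;> simp [hA, hB, this]

theorem pr_fin {α : Type*} (P : Dist α) (D : Set α) (hD : D.Finite) (c : ℝ)
    (h : ∀ x ∈ D, P.p x ≤ c) : P.pr D ≤ D.ncard * c := by
  lift D to Finset α using hD
  unfold Dist.pr
  rw [Set.ncard_coe_finset]
  have : ∑' x : (D : Set α), P.p x.1 = ∑ x ∈ D, P.p x := Finset.tsum_subtype' D P.p
  rw [this, ← nsmul_eq_mul]
  exact Finset.sum_le_card_nsmul _ _ _ h

theorem card_large {α : Type*} (P : Dist α) (c : ℝ) (hc : 0 < c) :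
    {x | c ≤ P.p x}.Finite ∧ ({x | c ≤ P.p x}.ncard : ℝ) * c ≤ 1 := by
  have hfin : {x | c ≤ P.p x}.Finite := by
    have h := P.hasSum.summable.tendsto_cofinite_zero.eventually_lt_const hc
    rw [Filter.eventually_cofinite] at h
    simpa using h
  refine ⟨hfin, ?_⟩
  rw [Set.ncard_eq_toFinset_card _ hfin, ← nsmul_eq_mul]
  refine (Finset.card_nsmul_le_sum _ P.p c fun x hx => ?_).trans
    (sum_le_hasSum _ (fun x _ => P.nonneg x) P.hasSum)
  simpa using hx

theorem card_short {α : Type*} {K : ℕ} (hK : 2 ≤ K) (φ : α → Word K) (ψ : Word K → α) (m : ℕ)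
    (D : Set α) (hD : ∀ x ∈ D, ψ (φ x) = x ∧ (φ x).1.length ≤ m) :
    D.Finite ∧ D.ncard ≤ K ^ (m + 1) := by
  let F : D → (Σ l : Fin (m + 1), List.Vector (Fin K) l) := fun x =>
    ⟨⟨(φ x.1).1.length, Nat.lt_succ_of_le (hD x.1 x.2).2⟩, ⟨(φ x.1).1, rfl⟩⟩
  have hF : Function.Injective F := by
    intro x y hxy
    have h1 : (φ x.1).1 = (φ y.1).1 := congrArg (fun s => s.2.1) hxy
    have h2 := Subtype.ext h1
    apply Subtype.ext
    rw [← (hD x.1 x.2).1, ← (hD y.1 y.2).1, h2]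
  have hfin : Finite D := Finite.of_injective F hF
  refine ⟨hfin, ?_⟩
  have h := Nat.card_le_card_of_injective F hF
  rw [Nat.card_coe_set_eq] at h
  refine h.trans ?_
  rw [Nat.card_eq_fintype_card, Fintype.card_sigma]
  simp only [card_vector, Fintype.card_fin]
  rw [← Finset.sum_range (fun l => K ^ l)]
  exact (Nat.geomSum_lt hK (by simp)).le

theorem exists_code {α : Type*} [Nonempty α] {K : ℕ} (A : Set α) (hA : A.Finite)
    (m : ℕ) (hm : 1 ≤ m) (hcard : A.ncard ≤ K ^ m) (hK : 2 ≤ K) :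
    ∃ (φ : α → Word K) (ψ : Word K → α), (∀ x ∈ A, ψ (φ x) = x) ∧ ∀ x, wlen (φ x) = m := by
  classical
  haveI : Finite A := hA
  haveI := Fintype.ofFinite A
  have hc : Fintype.card A ≤ Fintype.card (List.Vector (Fin K) m) := by
    rw [card_vector, Fintype.card_fin, ← Nat.card_eq_fintype_card, Nat.card_coe_set_eq]
    exact hcard
  obtain ⟨F⟩ := Function.Embedding.nonempty_of_card_le hc
  let toW : List.Vector (Fin K) m → Word K := fun v => ⟨v.1, by
    intro h; have := v.2; rw [h] at this; simp at this; omega⟩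
  have hinj : Function.Injective toW := fun v w h => Subtype.ext (congrArg (fun s => s.1) h)
  let v0 : List.Vector (Fin K) m := List.Vector.replicate m ⟨0, by omega⟩
  let φ : α → Word K := fun x => if h : x ∈ A then toW (F ⟨x, h⟩) else toW v0
  have hφ : Set.InjOn φ A := by
    intro x hx y hy h
    simp only [φ, hx, hy, dif_pos] at h
    exact congrArg Subtype.val (F.injective (hinj h))
  refine ⟨φ, Function.invFunOn φ A, fun x hx => hφ.leftInvOn_invFunOn hx, fun x => ?_⟩
  have : ∀ v, wlen (toW v) = m := fun v => by simp [wlen, toW, v.2]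
  simp only [φ]
  split_ifs <;> exact this _

theorem log_sum {𝒳 : Type*} (K : ℕ) (pX : Dist 𝒳) (n : ℕ) (x : Fin n → 𝒳)
    (h : ∏ i, pX.p (x i) ≠ 0) :
    ∑ i, Real.logb K (1 / pX.p (x i)) = - Real.logb K (∏ i, pX.p (x i)) := by
  rw [Finset.prod_ne_zero_iff] at h
  rw [Real.logb_prod _ _ fun i hi => h i hi, ← Finset.sum_neg_distrib]
  refine Finset.sum_congr rfl fun i _ => ?_
  rw [one_div, Real.logb_inv]

theorem first_opt {𝒳 : Type*} (K : ℕ) (X : Source 𝒳) (ε δ R : ℝ) (h : FirstAch K X ε δ R) :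
    OptFirstAch K X ε δ R := by
  obtain ⟨hR, φ, ψ, h1, h2⟩ := h
  refine ⟨hR, φ, ψ, fun γ hγ => ?_⟩
  have e1 := eventually_lt_of_limsup_lt (h1.trans_lt (lt_add_of_pos_right ε hγ))
    (isBoundedUnder_of ⟨1, fun n => pr_le_one _ _⟩)
  have e2 := eventually_lt_of_limsup_lt (h2.trans_lt (lt_add_of_pos_right δ hγ))
    (isBoundedUnder_of ⟨1, fun n => pr_le_one _ _⟩)
  obtain ⟨N, hN⟩ := eventually_atTop.1 (e1.and e2)
  exact ⟨fun i => N + i, fun a b hab => by simpa using hab, fun i =>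
    ⟨(hN _ (Nat.le_add_right _ _)).1.le, (hN _ (Nat.le_add_right _ _)).2.le⟩⟩

open Topology in
theorem converse {𝒳 : Type*} [Countable 𝒳] (K : ℕ) (hK : 2 ≤ K)
    (pX : Dist 𝒳) (X : Source 𝒳)
    (hX : ∀ (n : ℕ) (x : Fin n → 𝒳), (X n).p x = ∏ i, pX.p (x i))
    (hent : Summable fun x => pX.p x * Real.logb (K : ℝ) (1 / pX.p x))
    (H : ℝ) (hH : H = ∑' x, pX.p x * Real.logb (K : ℝ) (1 / pX.p x))
    (ε δ : ℝ) (hεδ : ε + δ < 1) (R : ℝ) (h : OptFirstAch K X ε δ R) : H ≤ R := by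
  by_contra! hlt
  obtain ⟨hR, φ, ψ, h⟩ := h
  have hK1 : (1 : ℝ) < K := by exact_mod_cast hK
  have hK0 : (0 : ℝ) < K := by linarith
  obtain ⟨ns, hmono, hns⟩ := h ((1 - ε - δ) / 8) (by linarith)
  set τ := (H - R) / 2 with hτ
  have hτ0 : 0 < τ := by rw [hτ]; linarith
  have hw := (wlln pX X hX _ hent τ hτ0).comp hmono.tendsto_atTop
  rw [← hH] at hw
  have hpow : Tendsto (fun n : ℕ => (K : ℝ) * ((K : ℝ) ^ (-τ)) ^ n) atTop (𝓝 0) := by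
    have := (tendsto_pow_atTop_nhds_zero_of_lt_one (r := (K : ℝ) ^ (-τ))
      (Real.rpow_nonneg hK0.le _)
      (Real.rpow_lt_one_of_one_lt_of_neg hK1 (by linarith))).const_mul (K : ℝ)
    simpa using this
  have hpow := hpow.comp hmono.tendsto_atTop
  have hγ : 0 < (1 - ε - δ) / 8 := by linarith
  obtain ⟨i, ⟨hi1, hi2⟩, hi3⟩ := (((hw.eventually_lt_const hγ).and
    (hpow.eventually_lt_const hγ)).and (eventually_ge_atTop 1)).exists
  obtain ⟨g1, g2⟩ := hns i
  simp only [Function.comp] at hi1 hi2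
  have hn1 : 1 ≤ ns i := hi3.trans (hmono.id_le i)
  generalize ns i = n at *
  have hn0 : (0 : ℝ) < n := by exact_mod_cast hn1
  set c : ℝ := (K : ℝ) ^ (-(n * (H - τ))) with hc
  have hc0 : 0 < c := Real.rpow_pos_of_pos hK0 _
  set m := ⌊(n : ℝ) * R⌋₊ with hm
  have hmR : (m : ℝ) ≤ n * R := Nat.floor_le (by positivity)
  set D : Set (Fin n → 𝒳) := {x | (ψ n (φ n x) = x ∧ (φ n x).1.length ≤ m) ∧ (X n).p x ≤ c} with hD
  obtain ⟨hDf, hDc⟩ := card_short hK (φ n) (ψ n) m D (fun x hx => hx.1)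
  have hDp := pr_fin (X n) D hDf c (fun x hx => hx.2)
  have hb : (D.ncard : ℝ) * c ≤ (K : ℝ) * ((K : ℝ) ^ (-τ)) ^ n := by
    have h1 : (D.ncard : ℝ) ≤ (K : ℝ) ^ (m + 1) := by exact_mod_cast hDc
    have h2 : (K : ℝ) ^ (m + 1) ≤ (K : ℝ) ^ (n * R + 1) := by
      rw [← Real.rpow_natCast]
      apply Real.rpow_le_rpow_of_exponent_le hK1.le
      push_cast; linarith
    calc (D.ncard : ℝ) * c ≤ (K : ℝ) ^ (n * R + 1) * c :=
          mul_le_mul_of_nonneg_right (h1.trans h2) hc0.le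
      _ = (K : ℝ) ^ (1 + (-τ) * n) := by
          rw [hc, ← Real.rpow_add hK0]; congr 1; rw [hτ]; ring
      _ = _ := by rw [Real.rpow_add hK0, Real.rpow_one, Real.rpow_mul hK0.le, Real.rpow_natCast]
  set B : Set (Fin n → 𝒳) := {x | τ ≤ |(∑ i, Real.logb (K : ℝ) (1 / pX.p (x i))) / n - H|} with hB
  have hcov : (1 : ℝ) ≤ (X n).pr ((({x | ψ n (φ n x) ≠ x} ∪ {x | wlen (φ n x) > n * R}) ∪ D) ∪ B) := by
    rw [← pr_univ (X n)]
    refine pr_mono' _ fun x _ h0 => ?_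
    by_cases h1 : ψ n (φ n x) = x
    swap
    · exact Or.inl (Or.inl (Or.inl h1))
    by_cases h2 : wlen (φ n x) > n * R
    · exact Or.inl (Or.inl (Or.inr h2))
    by_cases h3 : (X n).p x ≤ c
    · exact Or.inl (Or.inr ⟨⟨h1, Nat.le_floor (not_lt.1 h2)⟩, h3⟩)
    refine Or.inr ?_
    push Not at h3
    have h4 : -(n * (H - τ)) < Real.logb K ((X n).p x) := by
      rw [Real.lt_logb_iff_rpow_lt hK1 (hc0.trans h3)]; exact h3
    rw [hX] at h0 h4
    simp only [hB, Set.mem_setOf_eq]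
    rw [log_sum K pX n x h0, le_abs]
    right
    have : -Real.logb K (∏ i, pX.p (x i)) / n ≤ H - τ := by
      rw [div_le_iff₀ hn0]; linarith
    linarith
  have u1 := pr_union (X n) (({x | ψ n (φ n x) ≠ x} ∪ {x | wlen (φ n x) > n * R}) ∪ D) B
  have u2 := pr_union (X n) ({x | ψ n (φ n x) ≠ x} ∪ {x | wlen (φ n x) > n * R}) D
  have u3 := pr_union (X n) {x | ψ n (φ n x) ≠ x} {x | wlen (φ n x) > n * R}
  unfold errP at g1
  unfold ovP at g2
  linarith

open Topology in
theorem achiev {𝒳 : Type*} [Countable 𝒳] (K : ℕ) (hK : 2 ≤ K)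
    (pX : Dist 𝒳) (X : Source 𝒳)
    (hX : ∀ (n : ℕ) (x : Fin n → 𝒳), (X n).p x = ∏ i, pX.p (x i))
    (hent : Summable fun x => pX.p x * Real.logb (K : ℝ) (1 / pX.p x))
    (H : ℝ) (hH : H = ∑' x, pX.p x * Real.logb (K : ℝ) (1 / pX.p x))
    (ε δ : ℝ) (hε0 : 0 ≤ ε) (hδ0 : 0 ≤ δ) (τ : ℝ) (hτ : 0 < τ) :
    FirstAch K X ε δ (H + τ) := by
  have hK1 : (1 : ℝ) < K := by exact_mod_cast hK
  have hK0 : (0 : ℝ) < K := by linarith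
  have hH0 : 0 ≤ H := by
    rw [hH]
    refine tsum_nonneg fun x => ?_
    have hx1 : pX.p x ≤ 1 := le_hasSum pX.hasSum x fun y _ => pX.nonneg y
    rcases (pX.nonneg x).eq_or_lt with h0 | h0
    · simp [← h0]
    · exact mul_nonneg h0.le (Real.logb_nonneg hK1 (by rw [le_div_iff₀ h0]; linarith))
  haveI : Nonempty 𝒳 := by
    by_contra hne
    rw [not_nonempty_iff] at hne
    have := pX.hasSum.unique (hasSum_empty)
    norm_num at this
  have hw := wlln pX X hX _ hent (τ / 2) (by linarith)
  rw [← hH] at hw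
  have key : ∀ n : ℕ, ∃ (φ : (Fin n → 𝒳) → Word K) (ψ : Word K → (Fin n → 𝒳)),
      2 ≤ n * τ → (∀ x, (K : ℝ) ^ (-(n * (H + τ / 2))) ≤ (X n).p x → ψ (φ x) = x) ∧
        ∀ x, wlen (φ x) ≤ n * (H + τ) := by
    intro n
    by_cases hn : 2 ≤ n * τ
    swap
    · exact ⟨fun _ => ⟨[⟨0, by omega⟩], by simp⟩, fun _ => Classical.arbitrary _, fun h => absurd h hn⟩
    set c : ℝ := (K : ℝ) ^ (-(n * (H + τ / 2))) with hc
    have hc0 : 0 < c := Real.rpow_pos_of_pos hK0 _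
    obtain ⟨hf, hcard⟩ := card_large (X n) c hc0
    have hnH : 0 ≤ (n : ℝ) * H := by positivity
    have hm1 : (n : ℝ) * (H + τ / 2) ≤ ⌊(n : ℝ) * (H + τ)⌋₊ := by
      have := Nat.lt_floor_add_one ((n : ℝ) * (H + τ))
      linarith
    have hm0 : 1 ≤ ⌊(n : ℝ) * (H + τ)⌋₊ := Nat.le_floor (by push_cast; linarith)
    obtain ⟨φ, ψ, a, b⟩ := exists_code _ hf _ hm0 (by
      have h1 : ({x | c ≤ (X n).p x}.ncard : ℝ) ≤ (K : ℝ) ^ (n * (H + τ / 2)) := by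
        rw [hc, Real.rpow_neg hK0.le, ← div_eq_mul_inv,
          div_le_one (Real.rpow_pos_of_pos hK0 _)] at hcard
        rw [hc, Real.rpow_neg hK0.le]
        exact hcard
      have h2 := h1.trans (Real.rpow_le_rpow_of_exponent_le hK1.le hm1)
      rw [Real.rpow_natCast] at h2
      exact_mod_cast h2) hK
    refine ⟨φ, ψ, fun _ => ⟨fun x hx => a x hx, fun x => ?_⟩⟩
    rw [b]
    exact Nat.floor_le (by positivity)
  choose φ ψ h using key
  have hev : ∀ᶠ n : ℕ in atTop, 2 ≤ (n : ℝ) * τ :=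
    (tendsto_natCast_atTop_atTop.atTop_mul_const hτ).eventually_ge_atTop 2
  refine ⟨by linarith, φ, ψ, ?_, ?_⟩
  · have ht : Tendsto (fun n => errP (X n) (φ n) (ψ n)) atTop (𝓝 0) := by
      refine squeeze_zero' (Eventually.of_forall fun n => pr_nonneg _ _) ?_ hw
      filter_upwards [hev] with n hn
      have hn0 : (0 : ℝ) < n := by
        by_contra! h0
        nlinarith
      refine pr_mono' _ fun x hx h0 => ?_
      have h1 : (X n).p x < (K : ℝ) ^ (-(n * (H + τ / 2))) := by
        by_contra! h2
        exact hx ((h n hn).1 x h2)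
      have hpos := lt_of_le_of_ne ((X n).nonneg x) (Ne.symm h0)
      rw [← Real.logb_lt_iff_lt_rpow hK1 hpos] at h1
      rw [hX] at h0 h1
      simp only [Set.mem_setOf_eq]
      rw [log_sum K pX n x h0, le_abs]
      left
      have : H + τ / 2 ≤ -Real.logb K (∏ i, pX.p (x i)) / n := by
        rw [le_div_iff₀ hn0]; linarith
      linarith
    rw [ht.limsup_eq]; exact hε0
  · have ht : Tendsto (fun n : ℕ => ovP (X n) (φ n) (n * (H + τ))) atTop (𝓝 0) := by
      refine tendsto_const_nhds.congr' ?_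
      filter_upwards [hev] with n hn
      have : {x | wlen (φ n x) > n * (H + τ)} = ∅ := by
        ext x
        simpa using (h n hn).2 x
      unfold ovP
      rw [this, pr_eq]; simp
    rw [ht.limsup_eq]; exact hδ0

/-- stationary memoryless sources, first order:
R(ε,δ|X) = R*(ε,δ|X) = H(X). -/
theorem statement18 {𝒳 : Type*} [Countable 𝒳] (K : ℕ) (hK : 2 ≤ K)
    (pX : Dist 𝒳) (X : Source 𝒳)
    (hX : ∀ (n : ℕ) (x : Fin n → 𝒳), (X n).p x = ∏ i, pX.p (x i))
    (hent : Summable fun x => pX.p x * Real.logb (K : ℝ) (1 / pX.p x))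
    (H : ℝ) (hH : H = ∑' x, pX.p x * Real.logb (K : ℝ) (1 / pX.p x))
    (ε δ : ℝ) (hε0 : 0 ≤ ε) (hε1 : ε < 1) (hδ0 : 0 ≤ δ) (hδ1 : δ < 1) (hεδ : ε + δ < 1) :
    Ropt K X ε δ = H ∧ RoptStar K X ε δ = H := by
  have hsub : ∀ R, FirstAch K X ε δ R → OptFirstAch K X ε δ R := fun R => first_opt K X ε δ R
  have hlow : ∀ R, OptFirstAch K X ε δ R → H ≤ R :=
    fun R => converse K hK pX X hX hent H hH ε δ hεδ R
  have hup : ∀ τ > 0, FirstAch K X ε δ (H + τ) :=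
    fun τ hτ => achiev K hK pX X hX hent H hH ε δ hε0 hδ0 τ hτ
  constructor
  · refine le_antisymm (le_of_forall_pos_le_add fun τ hτ => ?_) ?_
    · exact csInf_le ⟨H, fun R hR => hlow R (hsub R hR)⟩ (hup τ hτ)
    · exact le_csInf ⟨H + 1, hup 1 one_pos⟩ fun R hR => hlow R (hsub R hR)
  · refine le_antisymm (le_of_forall_pos_le_add fun τ hτ => ?_) ?_
    · exact csInf_le ⟨H, fun R hR => hlow R hR⟩ (hsub _ (hup τ hτ))
    · exact le_csInf ⟨H + 1, hsub _ (hup 1 one_pos)⟩ fun R hR => hlow R hR
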